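/- In an optimal policy, whenever the rate strictly increases the transmitter or the receiver must have exhausted its energy: if r* is an optimal rate policy and r*_k < r*_{k+1} for some k ∈ {1,…,N−1}, then ∑_{i=1}^k f(r*_i) = ∑_{i=1}^k E_i or ∑_{i=1}^k φ(r*_i) = ∑_{i=1}^k Ē_i. -/

import Mathlib

open Finset

/-- A rate policy `r` is feasible for the single-user energy harvesting channel with
transmitter energies `E`, receiver energies `Ebar`, rate-to-power function `f`,
and decoding cost function `φ`, over slots `1,…,N`. -/
def SUFeasible (N : ℕ) (E Ebar : ℕ → ℝ) (f φ : ℝ → ℝ) (r : ℕ → ℝ) : Prop :=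
  (∀ i ∈ Finset.Icc 1 N, 0 ≤ r i) ∧
  (∀ k ∈ Finset.Icc 1 N,
      ∑ i ∈ Finset.Icc 1 k, f (r i) ≤ ∑ i ∈ Finset.Icc 1 k, E i) ∧
  (∀ k ∈ Finset.Icc 1 N,
      ∑ i ∈ Finset.Icc 1 k, φ (r i) ≤ ∑ i ∈ Finset.Icc 1 k, Ebar i)

open Topology in
theorem ev_right_lt (f : ℝ → ℝ) (hf : ContinuousOn f (Set.Ici 0)) (a c : ℝ) (ha : 0 ≤ a)
    (h : f a < c) : ∀ᶠ x in 𝓝[>] a, f x < c := by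
  have h1 : ContinuousWithinAt f (Set.Ioi a) a :=
    (hf a ha).mono (fun x hx => le_trans ha (le_of_lt hx))
  exact h1.eventually (gt_mem_nhds h)

theorem convex_shift (f : ℝ → ℝ) (hf : StrictConvexOn ℝ (Set.Ici 0) f) (a b x : ℝ) (ha : 0 ≤ a)
    (hax : a < x) (hxb : x < b) : f x + f (a + b - x) < f a + f b := by
  have hab : a < b := hax.trans hxb
  have hd : 0 < b - a := by linarith
  have hs : 0 < (x - a) / (b - a) := div_pos (by linarith) hd
  have ht : 0 < (b - x) / (b - a) := div_pos (by linarith) hd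
  have hst : (b - x) / (b - a) + (x - a) / (b - a) = 1 := by field_simp; ring
  have hb : b ∈ Set.Ici (0 : ℝ) := le_trans ha hab.le
  have h1 := hf.2 (show a ∈ Set.Ici (0 : ℝ) from ha) hb hab.ne ht hs hst
  have h2 := hf.2 (show a ∈ Set.Ici (0 : ℝ) from ha) hb hab.ne hs ht (by linarith)
  have e1 : (b - x) / (b - a) * a + (x - a) / (b - a) * b = x := by field_simp; ring
  have e2 : (x - a) / (b - a) * a + (b - x) / (b - a) * b = a + b - x := by field_simp; ring
  simp only [smul_eq_mul] at h1 h2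
  rw [e1] at h1
  rw [e2] at h2
  have e3 : (b - x) / (b - a) * f a + (x - a) / (b - a) * f a = f a := by
    rw [← add_mul, hst, one_mul]
  have e4 : (b - x) / (b - a) * f b + (x - a) / (b - a) * f b = f b := by
    rw [← add_mul, hst, one_mul]
  linarith

theorem sum_shift (g : ℝ → ℝ) (r : ℕ → ℝ) (k j : ℕ) (x y : ℝ) :
    ∑ i ∈ Finset.Icc 1 j, g (if i = k then x else if i = k + 1 then y else r i)
      = ∑ i ∈ Finset.Icc 1 j, g (r i)
        + (if k ∈ Finset.Icc 1 j then g x - g (r k) else 0)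
        + (if k + 1 ∈ Finset.Icc 1 j then g y - g (r (k + 1)) else 0) := by
  rw [← Finset.sum_ite_eq' (Finset.Icc 1 j) k (fun _ => g x - g (r k)),
    ← Finset.sum_ite_eq' (Finset.Icc 1 j) (k + 1) (fun _ => g y - g (r (k + 1))),
    ← Finset.sum_add_distrib, ← Finset.sum_add_distrib]
  refine Finset.sum_congr rfl fun i _ => ?_
  by_cases h1 : i = k
  · subst h1; simp
  · by_cases h2 : i = k + 1
    · subst h2; simp
    · simp [h1, h2]

theorem causal_shift (N : ℕ) (E : ℕ → ℝ) (g : ℝ → ℝ) (r : ℕ → ℝ) (k : ℕ) (x y : ℝ)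
    (h : ∀ j ∈ Finset.Icc 1 N,
      ∑ i ∈ Finset.Icc 1 j, g (r i) ≤ ∑ i ∈ Finset.Icc 1 j, E i)
    (h1 : g x < g (r k) + (∑ i ∈ Finset.Icc 1 k, E i - ∑ i ∈ Finset.Icc 1 k, g (r i)))
    (h2 : g x + g y < g (r k) + g (r (k + 1))) (hk : 1 ≤ k) :
    ∀ j ∈ Finset.Icc 1 N,
      ∑ i ∈ Finset.Icc 1 j, g (if i = k then x else if i = k + 1 then y else r i)
        ≤ ∑ i ∈ Finset.Icc 1 j, E i := by
  intro j hj
  have h3 := h j hj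
  rw [sum_shift]
  simp only [Finset.mem_Icc]
  rcases lt_trichotomy j k with hjk | hjk | hjk
  · rw [if_neg (by omega), if_neg (by omega)]; linarith
  · subst hjk
    rw [if_pos (by omega), if_neg (by omega)]; linarith
  · rw [if_pos (by omega), if_pos (by omega)]; linarith

/-- in an optimal policy, whenever the rate strictly increases, the
transmitter or the receiver must have exhausted its harvested energy up to that slot. -/
theorem optimal_policy_energy_exhausted_at_rate_increase
    (N : ℕ) (hN : 1 ≤ N)
    (E Ebar : ℕ → ℝ)
    (hE : ∀ i ∈ Finset.Icc 1 N, 0 ≤ E i)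
    (hEbar : ∀ i ∈ Finset.Icc 1 N, 0 ≤ Ebar i)
    (f φ : ℝ → ℝ)
    (hf_cont : ContinuousOn f (Set.Ici 0))
    (hf_mono : StrictMonoOn f (Set.Ici 0))
    (hf_conv : StrictConvexOn ℝ (Set.Ici 0) f)
    (hf_nonneg : ∀ x : ℝ, 0 ≤ x → 0 ≤ f x)
    (hf0 : f 0 = 0)
    (hphi_cont : ContinuousOn φ (Set.Ici 0))
    (hphi_mono : StrictMonoOn φ (Set.Ici 0))
    (hphi_conv : StrictConvexOn ℝ (Set.Ici 0) φ)
    (hphi_nonneg : ∀ x : ℝ, 0 ≤ x → 0 ≤ φ x)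
    (hphi0 : φ 0 = 0)
    (r : ℕ → ℝ)
    (hfeas : SUFeasible N E Ebar f φ r)
    (hopt : ∀ r' : ℕ → ℝ, SUFeasible N E Ebar f φ r' →
      ∑ i ∈ Finset.Icc 1 N, r' i ≤ ∑ i ∈ Finset.Icc 1 N, r i)
    (k : ℕ) (hk1 : 1 ≤ k) (hkN : k ≤ N - 1)
    (hinc : r k < r (k + 1)) :
    (∑ i ∈ Finset.Icc 1 k, f (r i) = ∑ i ∈ Finset.Icc 1 k, E i) ∨
    (∑ i ∈ Finset.Icc 1 k, φ (r i) = ∑ i ∈ Finset.Icc 1 k, Ebar i) := by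
  by_contra hcon
  push Not at hcon
  obtain ⟨hr, hF, hP⟩ := hfeas
  have hkm : k ∈ Finset.Icc 1 N := Finset.mem_Icc.2 ⟨hk1, by omega⟩
  have hkm' : k + 1 ∈ Finset.Icc 1 N := Finset.mem_Icc.2 ⟨by omega, by omega⟩
  have ha := hr k hkm
  have sF := lt_of_le_of_ne (hF k hkm) hcon.1
  have sP := lt_of_le_of_ne (hP k hkm) hcon.2
  obtain ⟨x, ⟨hx1, hx2⟩, hxb, hax⟩ := (((ev_right_lt f hf_cont (r k)
    (f (r k) + (∑ i ∈ Finset.Icc 1 k, E i - ∑ i ∈ Finset.Icc 1 k, f (r i))) ha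
      (by linarith)).and (ev_right_lt φ hphi_cont (r k)
    (φ (r k) + (∑ i ∈ Finset.Icc 1 k, Ebar i - ∑ i ∈ Finset.Icc 1 k, φ (r i))) ha
      (by linarith))).and ((eventually_nhdsWithin_of_eventually_nhds
        (gt_mem_nhds hinc)).and self_mem_nhdsWithin)).exists
  replace hax : r k < x := hax
  have c1 := convex_shift f hf_conv _ _ x ha hax hxb
  have c2 := convex_shift φ hphi_conv _ _ x ha hax hxb
  have hz : 0 ≤ r k + r (k + 1) - x := by linarith
  obtain ⟨y, ⟨hy1, hy2⟩, hy⟩ := (((ev_right_lt f hf_cont (r k + r (k + 1) - x)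
    (f (r k) + f (r (k + 1)) - f x) hz (by linarith)).and
    (ev_right_lt φ hphi_cont (r k + r (k + 1) - x)
    (φ (r k) + φ (r (k + 1)) - φ x) hz (by linarith))).and self_mem_nhdsWithin).exists
  replace hy : r k + r (k + 1) - x < y := hy
  have key := hopt (fun i => if i = k then x else if i = k + 1 then y else r i)
    ⟨fun i hi => by
      have := hr i hi
      dsimp only
      split_ifs <;> linarith,
     causal_shift N E f r k x y hF hx1 (by linarith) hk1,
     causal_shift N Ebar φ r k x y hP hx2 (by linarith) hk1⟩
  have e := sum_shift (fun t => t) r k N x y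
  rw [if_pos hkm, if_pos hkm'] at e
  linarith
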